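/- arXiv:2409.01697 — 2 statements merged into one kernel-verified Lean document; each statement's English description precedes it below -/
import Mathlib

section
/- If x* is a local-nonglobal minimizer of (GTRE), or a local-nonglobal minimizer of (GTR), then f₁(x*) = 0 and ∇f₁(x*) = 2(A₁x* + b₁) ≠ 0 (i.e., x* is a regular point of the constraint). -/
open Matrix Finset

/-- Euclidean norm of a vector in `Fin n → ℝ`. -/
noncomputable def euclNorm {n : ℕ} (x : Fin n → ℝ) : ℝ := Real.sqrt (x ⬝ᵥ x)

/-- Objective `f₀(x) = xᵀA₀x + 2b₀ᵀx`. -/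
noncomputable def qf0 {n : ℕ} (A0 : Matrix (Fin n) (Fin n) ℝ) (b0 : Fin n → ℝ)
    (x : Fin n → ℝ) : ℝ := x ⬝ᵥ A0.mulVec x + 2 * (b0 ⬝ᵥ x)

/-- Constraint `f₁(x) = xᵀA₁x + 2b₁ᵀx + c₁`. -/
noncomputable def qf1 {n : ℕ} (A1 : Matrix (Fin n) (Fin n) ℝ) (b1 : Fin n → ℝ) (c1 : ℝ)
    (x : Fin n → ℝ) : ℝ := x ⬝ᵥ A1.mulVec x + 2 * (b1 ⬝ᵥ x) + c1

/-- Local minimizer of (GTRE): feasible, and locally optimal among feasible points. -/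
def IsLocalMinGTRE {n : ℕ} (A0 A1 : Matrix (Fin n) (Fin n) ℝ) (b0 b1 : Fin n → ℝ) (c1 : ℝ)
    (xs : Fin n → ℝ) : Prop :=
  qf1 A1 b1 c1 xs = 0 ∧ ∃ δ > (0:ℝ), ∀ x : Fin n → ℝ,
    qf1 A1 b1 c1 x = 0 → euclNorm (x - xs) < δ → qf0 A0 b0 xs ≤ qf0 A0 b0 x

/-- Global minimizer of (GTRE). -/
def IsGlobalMinGTRE {n : ℕ} (A0 A1 : Matrix (Fin n) (Fin n) ℝ) (b0 b1 : Fin n → ℝ) (c1 : ℝ)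
    (xs : Fin n → ℝ) : Prop :=
  qf1 A1 b1 c1 xs = 0 ∧ ∀ x : Fin n → ℝ, qf1 A1 b1 c1 x = 0 → qf0 A0 b0 xs ≤ qf0 A0 b0 x

/-- Local-nonglobal minimizer of (GTRE). -/
def IsLNGMinGTRE {n : ℕ} (A0 A1 : Matrix (Fin n) (Fin n) ℝ) (b0 b1 : Fin n → ℝ) (c1 : ℝ)
    (xs : Fin n → ℝ) : Prop :=
  IsLocalMinGTRE A0 A1 b0 b1 c1 xs ∧ ¬ IsGlobalMinGTRE A0 A1 b0 b1 c1 xs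

/-- Strict local minimizer of (GTRE). -/
def IsStrictLocalMinGTRE {n : ℕ} (A0 A1 : Matrix (Fin n) (Fin n) ℝ) (b0 b1 : Fin n → ℝ)
    (c1 : ℝ) (xs : Fin n → ℝ) : Prop :=
  qf1 A1 b1 c1 xs = 0 ∧ ∃ δ > (0:ℝ), ∀ x : Fin n → ℝ,
    qf1 A1 b1 c1 x = 0 → x ≠ xs → euclNorm (x - xs) < δ → qf0 A0 b0 xs < qf0 A0 b0 x

/-- Strict local-nonglobal minimizer of (GTRE). -/
def IsStrictLNGMinGTRE {n : ℕ} (A0 A1 : Matrix (Fin n) (Fin n) ℝ) (b0 b1 : Fin n → ℝ)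
    (c1 : ℝ) (xs : Fin n → ℝ) : Prop :=
  IsStrictLocalMinGTRE A0 A1 b0 b1 c1 xs ∧ ¬ IsGlobalMinGTRE A0 A1 b0 b1 c1 xs

/-- Local minimizer of (GTR). -/
def IsLocalMinGTR {n : ℕ} (A0 A1 : Matrix (Fin n) (Fin n) ℝ) (b0 b1 : Fin n → ℝ) (c1 : ℝ)
    (xs : Fin n → ℝ) : Prop :=
  qf1 A1 b1 c1 xs ≤ 0 ∧ ∃ δ > (0:ℝ), ∀ x : Fin n → ℝ,
    qf1 A1 b1 c1 x ≤ 0 → euclNorm (x - xs) < δ → qf0 A0 b0 xs ≤ qf0 A0 b0 x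

/-- Global minimizer of (GTR). -/
def IsGlobalMinGTR {n : ℕ} (A0 A1 : Matrix (Fin n) (Fin n) ℝ) (b0 b1 : Fin n → ℝ) (c1 : ℝ)
    (xs : Fin n → ℝ) : Prop :=
  qf1 A1 b1 c1 xs ≤ 0 ∧ ∀ x : Fin n → ℝ, qf1 A1 b1 c1 x ≤ 0 → qf0 A0 b0 xs ≤ qf0 A0 b0 x

/-- Local-nonglobal minimizer of (GTR). -/
def IsLNGMinGTR {n : ℕ} (A0 A1 : Matrix (Fin n) (Fin n) ℝ) (b0 b1 : Fin n → ℝ) (c1 : ℝ)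
    (xs : Fin n → ℝ) : Prop :=
  IsLocalMinGTR A0 A1 b0 b1 c1 xs ∧ ¬ IsGlobalMinGTR A0 A1 b0 b1 c1 xs

/-- Strict local minimizer of (GTR). -/
def IsStrictLocalMinGTR {n : ℕ} (A0 A1 : Matrix (Fin n) (Fin n) ℝ) (b0 b1 : Fin n → ℝ)
    (c1 : ℝ) (xs : Fin n → ℝ) : Prop :=
  qf1 A1 b1 c1 xs ≤ 0 ∧ ∃ δ > (0:ℝ), ∀ x : Fin n → ℝ,
    qf1 A1 b1 c1 x ≤ 0 → x ≠ xs → euclNorm (x - xs) < δ → qf0 A0 b0 xs < qf0 A0 b0 x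

/-- Strict local-nonglobal minimizer of (GTR). -/
def IsStrictLNGMinGTR {n : ℕ} (A0 A1 : Matrix (Fin n) (Fin n) ℝ) (b0 b1 : Fin n → ℝ)
    (c1 : ℝ) (xs : Fin n → ℝ) : Prop :=
  IsStrictLocalMinGTR A0 A1 b0 b1 c1 xs ∧ ¬ IsGlobalMinGTR A0 A1 b0 b1 c1 xs

theorem qf0_add_smul {n : ℕ} (A : Matrix (Fin n) (Fin n) ℝ) (b x d : Fin n → ℝ) (t : ℝ) :
    qf0 A b (x + t • d) = qf0 A b x
      + (t * (x ⬝ᵥ A.mulVec d + d ⬝ᵥ A.mulVec x + 2 * (b ⬝ᵥ d)) + t ^ 2 * (d ⬝ᵥ A.mulVec d)) := by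
  simp only [qf0, mulVec_add, mulVec_smul, dotProduct_add, add_dotProduct, dotProduct_smul,
    smul_dotProduct, smul_eq_mul]
  ring

theorem qf1_add_smul {n : ℕ} {A : Matrix (Fin n) (Fin n) ℝ} (hA : A.IsSymm) (b : Fin n → ℝ)
    (c : ℝ) (x d : Fin n → ℝ) (t : ℝ) :
    qf1 A b c (x + t • d) = qf1 A b c x
      + t * (((2 : ℝ) • (A.mulVec x + b)) ⬝ᵥ d) + t ^ 2 * (d ⬝ᵥ A.mulVec d) := by
  have hx : x ⬝ᵥ A.mulVec d = A.mulVec x ⬝ᵥ d := by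
    rw [dotProduct_mulVec, ← mulVec_transpose, hA.eq]
  simp only [qf1, mulVec_add, mulVec_smul, dotProduct_add, add_dotProduct, dotProduct_smul,
    smul_dotProduct, smul_eq_mul, hx, dotProduct_comm d (A.mulVec x)]
  ring

theorem continuous_euclNorm {n : ℕ} : Continuous (euclNorm : (Fin n → ℝ) → ℝ) := by
  unfold euclNorm dotProduct
  fun_prop

theorem continuous_qf1 {n : ℕ} (A : Matrix (Fin n) (Fin n) ℝ) (b : Fin n → ℝ) (c : ℝ) :
    Continuous (qf1 A b c) := by
  unfold qf1 mulVec dotProduct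
  fun_prop

/-- A quadratic polynomial vanishing at `0` and nonnegative near `0` is nonnegative at `1`. -/
theorem add_nonneg_of_eventually_quadratic_nonneg {l q : ℝ}
    (h : ∀ᶠ t : ℝ in nhds 0, 0 ≤ t * l + t ^ 2 * q) : 0 ≤ l + q := by
  obtain ⟨ε, hε, H⟩ := Metric.eventually_nhds_iff.1 h
  obtain ⟨t, ht0, ht⟩ := exists_between (lt_min hε one_pos)
  obtain ⟨htε, ht1⟩ := lt_min_iff.1 ht
  have hpos := H (y := t) (by rwa [Real.dist_0_eq_abs, abs_of_pos ht0])
  have hneg := H (y := -t) (by rwa [Real.dist_0_eq_abs, abs_neg, abs_of_pos ht0])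
  have hq : 0 ≤ q := by
    by_contra! hq
    nlinarith [mul_pos ht0 ht0]
  have hl : 0 ≤ l + t * q := by
    by_contra! hl
    nlinarith
  nlinarith

/-- If `x` minimizes `f₀` locally on `S`, and `S` contains a neighbourhood of `x` in the line
through `x` and `y`, then `f₀ x ≤ f₀ y`. -/
theorem qf0_le_of_eventually_mem {n : ℕ} {A : Matrix (Fin n) (Fin n) ℝ} {b x : Fin n → ℝ}
    {S : Set (Fin n → ℝ)} {δ : ℝ} (hδ : 0 < δ)
    (hmin : ∀ z ∈ S, euclNorm (z - x) < δ → qf0 A b x ≤ qf0 A b z) (y : Fin n → ℝ)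
    (hS : ∀ᶠ t : ℝ in nhds 0, x + t • (y - x) ∈ S) : qf0 A b x ≤ qf0 A b y := by
  have hnorm : ∀ᶠ t : ℝ in nhds 0, euclNorm (t • (y - x)) < δ := by
    have hcont : Continuous fun t : ℝ => euclNorm (t • (y - x)) :=
      continuous_euclNorm.comp (by fun_prop)
    exact hcont.continuousAt.eventually_lt_const (by simpa [euclNorm] using hδ)
  have key := add_nonneg_of_eventually_quadratic_nonneg
    (l := x ⬝ᵥ A.mulVec (y - x) + (y - x) ⬝ᵥ A.mulVec x + 2 * (b ⬝ᵥ (y - x)))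
    (q := (y - x) ⬝ᵥ A.mulVec (y - x)) (by
      filter_upwards [hS, hnorm] with t ht htδ
      have := hmin _ ht (by rwa [add_sub_cancel_left])
      rw [qf0_add_smul] at this
      linarith)
  have hy := qf0_add_smul A b x (y - x) 1
  rw [one_smul, add_sub_cancel] at hy
  linarith

/-- At a zero of `f₁` where the gradient vanishes, `f₁` is homogeneous of degree two about it. -/
theorem qf1_add_smul_sub {n : ℕ} {A : Matrix (Fin n) (Fin n) ℝ} (hA : A.IsSymm)
    {b : Fin n → ℝ} {c : ℝ} {x : Fin n → ℝ} (hx : qf1 A b c x = 0)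
    (hgrad : (2 : ℝ) • (A.mulVec x + b) = 0) (y : Fin n → ℝ) (t : ℝ) :
    qf1 A b c (x + t • (y - x)) = t ^ 2 * qf1 A b c y := by
  have hy := qf1_add_smul hA b c x (y - x) 1
  rw [one_smul, add_sub_cancel] at hy
  rw [qf1_add_smul hA, hy, hx, hgrad, zero_dotProduct]
  ring

theorem stmt0 {n : ℕ} (hn : 1 ≤ n)
    (A0 A1 : Matrix (Fin n) (Fin n) ℝ) (hA0 : A0.IsSymm) (hA1 : A1.IsSymm)
    (b0 b1 : Fin n → ℝ) (c1 : ℝ) (xs : Fin n → ℝ)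
    (hx : IsLNGMinGTRE A0 A1 b0 b1 c1 xs ∨ IsLNGMinGTR A0 A1 b0 b1 c1 xs) :
    qf1 A1 b1 c1 xs = 0 ∧ (2 : ℝ) • (A1.mulVec xs + b1) ≠ 0 := by
  rcases hx with ⟨⟨hfeas, δ, hδ, hmin⟩, hglob⟩ | ⟨⟨hfeas, δ, hδ, hmin⟩, hglob⟩
  · refine ⟨hfeas, fun hgrad => hglob ⟨hfeas, fun y hy => ?_⟩⟩
    refine qf0_le_of_eventually_mem (S := {z | qf1 A1 b1 c1 z = 0}) hδ hmin y (.of_forall ?_)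
    intro t
    rw [Set.mem_ofPred_eq, qf1_add_smul_sub hA1 hfeas hgrad, hy, mul_zero]
  · have hact : qf1 A1 b1 c1 xs = 0 := by
      refine hfeas.eq_or_lt.resolve_right fun hlt => hglob ⟨hfeas, fun y _ => ?_⟩
      refine qf0_le_of_eventually_mem (S := {z | qf1 A1 b1 c1 z ≤ 0}) hδ hmin y ?_
      have hcont : Continuous fun t : ℝ => qf1 A1 b1 c1 (xs + t • (y - xs)) :=
        (continuous_qf1 A1 b1 c1).comp (by fun_prop)
      exact (hcont.continuousAt.eventually_lt_const (by simpa using hlt)).mono fun _ => le_of_lt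
    refine ⟨hact, fun hgrad => hglob ⟨hfeas, fun y hy => ?_⟩⟩
    refine qf0_le_of_eventually_mem (S := {z | qf1 A1 b1 c1 z ≤ 0}) hδ hmin y (.of_forall ?_)
    intro t
    rw [Set.mem_ofPred_eq, qf1_add_smul_sub hA1 hact hgrad]
    exact mul_nonpos_of_nonneg_of_nonpos (sq_nonneg t) hy
end

section
/- If x* is a local-nonglobal minimizer of (GTRE) or of (GTR), and μ* ∈ ℝ is a Lagrangian multiplier satisfying (A₀x* + b₀) + μ*(A₁x* + b₁) = 0, then the symmetric matrix A₀ + μ*A₁ has exactly one negative eigenvalue (counted with multiplicity). -/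
open Matrix Finset

open Filter Topology in
lemma eventually_euclNorm_sub_lt {n : ℕ} (x : Fin n → ℝ) {δ : ℝ} (hδ : 0 < δ) :
    ∀ᶠ y in 𝓝 x, euclNorm (y - x) < δ := by
  have hc : Continuous fun y : Fin n → ℝ => euclNorm (y - x) := by
    unfold euclNorm dotProduct
    fun_prop
  have h := hc.tendsto x
  simp only [sub_self] at h
  rw [show euclNorm (0 : Fin n → ℝ) = 0 by simp [euclNorm]] at h
  exact h.eventually_lt_const hδ

lemma dotProduct_mulVec_comm_of_isSymm {n : ℕ} {A : Matrix (Fin n) (Fin n) ℝ} (hA : A.IsSymm)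
    (x y : Fin n → ℝ) : x ⬝ᵥ A.mulVec y = y ⬝ᵥ A.mulVec x := by
  rw [dotProduct_comm, ← vecMul_transpose, hA.eq, ← dotProduct_mulVec]

lemma dotProduct_mulVec_add_self {n : ℕ} {A : Matrix (Fin n) (Fin n) ℝ} (hA : A.IsSymm)
    (x y : Fin n → ℝ) :
    (x + y) ⬝ᵥ A.mulVec (x + y) =
      x ⬝ᵥ A.mulVec x + 2 * (x ⬝ᵥ A.mulVec y) + y ⬝ᵥ A.mulVec y := by
  simp only [mulVec_add, dotProduct_add, add_dotProduct]
  rw [dotProduct_mulVec_comm_of_isSymm hA y x]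
  ring

lemma qf0_add {n : ℕ} {A : Matrix (Fin n) (Fin n) ℝ} (hA : A.IsSymm) (b x d : Fin n → ℝ) :
    qf0 A b (x + d) = qf0 A b x + 2 * ((A.mulVec x + b) ⬝ᵥ d) + d ⬝ᵥ A.mulVec d := by
  simp only [qf0, dotProduct_mulVec_add_self hA, dotProduct_add, add_dotProduct]
  rw [dotProduct_mulVec_comm_of_isSymm hA x d, dotProduct_comm (A.mulVec x) d]
  ring

lemma qf1_add {n : ℕ} {A : Matrix (Fin n) (Fin n) ℝ} (hA : A.IsSymm) (b : Fin n → ℝ) (c : ℝ)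
    (x d : Fin n → ℝ) :
    qf1 A b c (x + d) = qf1 A b c x + 2 * ((A.mulVec x + b) ⬝ᵥ d) + d ⬝ᵥ A.mulVec d := by
  have h := qf0_add hA b x d
  simp only [qf0, qf1] at h ⊢
  linarith

lemma dotProduct_mulVec_smul_self {n : ℕ} (A : Matrix (Fin n) (Fin n) ℝ) (t : ℝ)
    (d : Fin n → ℝ) : (t • d) ⬝ᵥ A.mulVec (t • d) = t ^ 2 * (d ⬝ᵥ A.mulVec d) := by
  simp only [mulVec_smul, smul_dotProduct, dotProduct_smul, smul_eq_mul]
  ring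

open Filter Topology in
/-- A root of `a σ + p + q t σ + r t² σ² = 0`, continuous in `t` near `0`. -/
lemma exists_tendsto_root {a : ℝ} (ha : 0 < a) (p q r : ℝ) :
    ∃ σ : ℝ → ℝ, Tendsto σ (𝓝 0) (𝓝 (σ 0)) ∧
      ∀ᶠ t in 𝓝 (0 : ℝ), a * σ t + p + q * t * σ t + r * t ^ 2 * σ t ^ 2 = 0 := by
  let D : ℝ → ℝ := fun t => (a + q * t) ^ 2 - 4 * (r * t ^ 2) * p
  let S : ℝ → ℝ := fun t => a + q * t + Real.sqrt (D t)
  have hD : Continuous D := by fun_prop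
  have hS : Continuous S := by fun_prop
  have hD0 : 0 < D 0 := by simp only [D]; ring_nf; positivity
  have hS0 : 0 < S 0 := by simp only [S, mul_zero, add_zero]; positivity
  refine ⟨fun t => -2 * p / S t, ?_, ?_⟩
  · exact tendsto_const_nhds.div hS.continuousAt hS0.ne'
  · filter_upwards [hD.continuousAt.eventually_const_lt hD0,
      hS.continuousAt.eventually_const_lt hS0] with t hDt hSt
    have hsq : (S t - (a + q * t)) ^ 2 = (a + q * t) ^ 2 - 4 * (r * t ^ 2) * p := by
      simp only [S, add_sub_cancel_left]
      exact Real.sq_sqrt hDt.le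
    have hne := hSt.ne'
    field_simp
    linear_combination p * hsq

open Filter Topology in
/-- Second-order necessary condition along the tangent space of the constraint. -/
lemma IsLocalMinGTRE.tangent_nonneg {n : ℕ} {A0 A1 : Matrix (Fin n) (Fin n) ℝ}
    (hA0 : A0.IsSymm) (hA1 : A1.IsSymm) {b0 b1 : Fin n → ℝ} {c1 : ℝ} {x : Fin n → ℝ} {μ : ℝ}
    (h : IsLocalMinGTRE A0 A1 b0 b1 c1 x)
    (hstat : (A0.mulVec x + b0) + μ • (A1.mulVec x + b1) = 0)
    (hg : A1.mulVec x + b1 ≠ 0) {d : Fin n → ℝ} (hd : (A1.mulVec x + b1) ⬝ᵥ d = 0) :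
    0 ≤ d ⬝ᵥ (A0 + μ • A1).mulVec d := by
  obtain ⟨hx, δ, hδ, hmin⟩ := h
  set g := A1.mulVec x + b1 with hgdef
  have hH : (A0 + μ • A1).IsSymm := hA0.add (hA1.smul μ)
  have hgg : 0 < g ⬝ᵥ g :=
    lt_of_le_of_ne (Finset.sum_nonneg fun i _ => mul_self_nonneg _)
      (fun e => hg (dotProduct_self_eq_zero.1 e.symm))
  obtain ⟨σ, hσ, hroot⟩ := exists_tendsto_root (a := 2 * (g ⬝ᵥ g)) (by positivity)
    (d ⬝ᵥ A1.mulVec d) (2 * (d ⬝ᵥ A1.mulVec g)) (g ⬝ᵥ A1.mulVec g)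
  have hid : Tendsto (fun t : ℝ => t) (𝓝 0) (𝓝 0) := tendsto_id
  have hcurve : Tendsto (fun t : ℝ => x + (t • d + (t ^ 2 * σ t) • g)) (𝓝 0) (𝓝 x) := by
    have := (tendsto_const_nhds (x := x)).add ((hid.smul_const d).add
      (((hid.pow 2).mul hσ).smul_const g))
    simpa using this
  have hexp (B : Matrix (Fin n) (Fin n) ℝ) (hB : B.IsSymm) (t : ℝ) :
      (t • d + (t ^ 2 * σ t) • g) ⬝ᵥ B.mulVec (t • d + (t ^ 2 * σ t) • g) =
        t ^ 2 * (d ⬝ᵥ B.mulVec d + 2 * (t * σ t) * (d ⬝ᵥ B.mulVec g)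
          + (t * σ t) ^ 2 * (g ⬝ᵥ B.mulVec g)) := by
    rw [dotProduct_mulVec_add_self hB, dotProduct_mulVec_smul_self, dotProduct_mulVec_smul_self]
    simp only [mulVec_smul, smul_dotProduct, dotProduct_smul, smul_eq_mul]
    ring
  have hev : ∀ᶠ t in 𝓝[≠] (0 : ℝ), 0 ≤ d ⬝ᵥ (A0 + μ • A1).mulVec d
      + 2 * (t * σ t) * (d ⬝ᵥ (A0 + μ • A1).mulVec g)
      + (t * σ t) ^ 2 * (g ⬝ᵥ (A0 + μ • A1).mulVec g) := by
    filter_upwards [nhdsWithin_le_nhds hroot,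
      nhdsWithin_le_nhds (hcurve.eventually (eventually_euclNorm_sub_lt x hδ)),
      self_mem_nhdsWithin] with t h1 h2 ht
    have hgt : g ⬝ᵥ (t • d + (t ^ 2 * σ t) • g) = t ^ 2 * σ t * (g ⬝ᵥ g) := by
      simp [dotProduct_add, dotProduct_smul, hd]
    have hf1 : 2 * (g ⬝ᵥ (t • d + (t ^ 2 * σ t) • g)) + (t • d + (t ^ 2 * σ t) • g) ⬝ᵥ
        A1.mulVec (t • d + (t ^ 2 * σ t) • g) = 0 := by
      rw [hexp A1 hA1, hgt]
      linear_combination t ^ 2 * h1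
    have hle := hmin _ (by rw [qf1_add hA1, hx, ← hgdef]; linarith) h2
    rw [qf0_add hA0] at hle
    have hs := congrArg (· ⬝ᵥ (t • d + (t ^ 2 * σ t) • g)) hstat
    simp only [add_dotProduct (_ + b0), smul_dotProduct, zero_dotProduct, smul_eq_mul] at hs
    have hHt := hexp (A0 + μ • A1) hH t
    rw [add_mulVec, dotProduct_add, smul_mulVec, dotProduct_smul, smul_eq_mul] at hHt
    have ht2 : 0 < t ^ 2 := by have : t ≠ 0 := ht; positivity
    refine nonneg_of_mul_nonneg_right (a := t ^ 2) ?_ ht2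
    rw [← hHt]
    linear_combination hle - μ * hf1 + 2 * hs
  have hlim : Tendsto (fun t : ℝ => d ⬝ᵥ (A0 + μ • A1).mulVec d
      + 2 * (t * σ t) * (d ⬝ᵥ (A0 + μ • A1).mulVec g)
      + (t * σ t) ^ 2 * (g ⬝ᵥ (A0 + μ • A1).mulVec g)) (𝓝[≠] 0)
      (𝓝 (d ⬝ᵥ (A0 + μ • A1).mulVec d)) := by
    have hts := hid.mul hσ
    have := ((tendsto_const_nhds (x := d ⬝ᵥ (A0 + μ • A1).mulVec d)).add
      ((hts.const_mul 2).mul_const (d ⬝ᵥ (A0 + μ • A1).mulVec g))).add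
      ((hts.pow 2).mul_const (g ⬝ᵥ (A0 + μ • A1).mulVec g))
    simp only [zero_mul, mul_zero, add_zero, ne_eq, OfNat.ofNat_ne_zero, not_false_eq_true,
      zero_pow] at this
    exact this.mono_left nhdsWithin_le_nhds
  exact ge_of_tendsto hlim hev

open Filter Topology in
lemma eventually_euclNorm_smul_lt {n : ℕ} (x d : Fin n → ℝ) {δ : ℝ} (hδ : 0 < δ) :
    ∀ᶠ t in 𝓝[>] (0 : ℝ), euclNorm (x + t • d - x) < δ := by
  have hc : Tendsto (fun t : ℝ => x + t • d) (𝓝 0) (𝓝 x) := by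
    have : Continuous fun t : ℝ => x + t • d := by fun_prop
    simpa using this.tendsto 0
  exact nhdsWithin_le_nhds (hc.eventually (eventually_euclNorm_sub_lt x hδ))

open Filter Topology in
/-- At a singular point of the constraint the feasible displacements form a cone, on which a
local minimizer is global. -/
lemma IsLNGMinGTRE.gradient_ne_zero {n : ℕ} {A0 A1 : Matrix (Fin n) (Fin n) ℝ}
    (hA0 : A0.IsSymm) (hA1 : A1.IsSymm) {b0 b1 : Fin n → ℝ} {c1 : ℝ} {x : Fin n → ℝ} {μ : ℝ}
    (h : IsLNGMinGTRE A0 A1 b0 b1 c1 x)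
    (hstat : (A0.mulVec x + b0) + μ • (A1.mulVec x + b1) = 0) :
    A1.mulVec x + b1 ≠ 0 := by
  intro hg
  obtain ⟨⟨hx, δ, hδ, hmin⟩, hng⟩ := h
  rw [hg, smul_zero, add_zero] at hstat
  refine hng ⟨hx, fun y hy => ?_⟩
  obtain ⟨d, rfl⟩ : ∃ d, y = x + d := ⟨y - x, by simp⟩
  obtain ⟨t, ht, ht0⟩ :=
    ((eventually_euclNorm_smul_lt x d hδ).and self_mem_nhdsWithin).exists
  have ht0 : 0 < t := ht0
  have h1 := hmin (x + t • d) (by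
    rw [qf1_add hA1, hx, hg] at hy
    rw [qf1_add hA1, hx, hg, dotProduct_mulVec_smul_self]
    simp only [zero_dotProduct, mul_zero, zero_add] at hy ⊢
    rw [hy, mul_zero]) ht
  rw [qf0_add hA0, hstat, dotProduct_mulVec_smul_self] at h1
  rw [qf0_add hA0, hstat]
  simp only [zero_dotProduct, mul_zero, add_zero, le_add_iff_nonneg_right] at h1 ⊢
  exact nonneg_of_mul_nonneg_right h1 (by positivity)

open Filter Topology in
lemma eventually_lin_add_sq_neg {a : ℝ} (ha : a < 0) (b : ℝ) :
    ∀ᶠ t in 𝓝[>] (0 : ℝ), t * a + t ^ 2 * b < 0 := by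
  have hc : Continuous fun t : ℝ => a + t * b := by fun_prop
  have h0 : a + 0 * b < 0 := by simpa using ha
  filter_upwards [nhdsWithin_le_nhds (hc.continuousAt.eventually_lt_const h0),
    self_mem_nhdsWithin] with t h1 ht
  have ht : 0 < t := ht
  calc t * a + t ^ 2 * b = t * (a + t * b) := by ring
    _ < 0 := mul_neg_of_pos_of_neg ht h1

/-- An unconstrained local minimizer of a quadratic is global, so the constraint is active at a
local-nonglobal minimizer. -/
lemma IsLNGMinGTR.constraint_active {n : ℕ} {A0 A1 : Matrix (Fin n) (Fin n) ℝ}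
    (hA0 : A0.IsSymm) (hA1 : A1.IsSymm) {b0 b1 : Fin n → ℝ} {c1 : ℝ} {x : Fin n → ℝ}
    (h : IsLNGMinGTR A0 A1 b0 b1 c1 x) : qf1 A1 b1 c1 x = 0 := by
  obtain ⟨⟨hx, δ, hδ, hmin⟩, hng⟩ := h
  by_contra hne
  have hlt : qf1 A1 b1 c1 x < 0 := lt_of_le_of_ne hx hne
  have hray (d : Fin n → ℝ) : ∀ᶠ t in nhdsWithin (0 : ℝ) (Set.Ioi 0),
      0 ≤ 2 * t * ((A0.mulVec x + b0) ⬝ᵥ d) + t ^ 2 * (d ⬝ᵥ A0.mulVec d) := by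
    have hc : Continuous fun t : ℝ => qf1 A1 b1 c1 (x + t • d) := by
      simp only [qf1_add hA1, dotProduct_mulVec_smul_self, dotProduct_smul]
      fun_prop
    have h0 : qf1 A1 b1 c1 (x + (0 : ℝ) • d) < 0 := by simpa using hlt
    filter_upwards [eventually_euclNorm_smul_lt x d hδ,
      nhdsWithin_le_nhds (hc.continuousAt.eventually_lt_const h0)] with t h1 h2
    have := hmin _ h2.le h1
    rw [qf0_add hA0, dotProduct_mulVec_smul_self, dotProduct_smul, smul_eq_mul] at this
    linarith
  have hlin (d : Fin n → ℝ) : 0 ≤ (A0.mulVec x + b0) ⬝ᵥ d := by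
    by_contra! hneg
    obtain ⟨t, h1, h2⟩ := ((hray d).and (eventually_lin_add_sq_neg
      (show 2 * ((A0.mulVec x + b0) ⬝ᵥ d) < 0 by linarith) (d ⬝ᵥ A0.mulVec d))).exists
    linarith
  have hlin0 (d : Fin n → ℝ) : (A0.mulVec x + b0) ⬝ᵥ d = 0 := by
    have := hlin (-d)
    rw [dotProduct_neg] at this
    linarith [hlin d]
  refine hng ⟨hx, fun y _ => ?_⟩
  obtain ⟨d, rfl⟩ : ∃ d, y = x + d := ⟨y - x, by simp⟩
  obtain ⟨t, h1, ht⟩ := ((hray d).and self_mem_nhdsWithin).exists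
  have ht : 0 < t := ht
  rw [hlin0, mul_zero, zero_add] at h1
  rw [qf0_add hA0, hlin0]
  linarith [nonneg_of_mul_nonneg_right h1 (by positivity)]

lemma IsLNGMinGTR.gradient_ne_zero {n : ℕ} {A0 A1 : Matrix (Fin n) (Fin n) ℝ}
    (hA0 : A0.IsSymm) (hA1 : A1.IsSymm) {b0 b1 : Fin n → ℝ} {c1 : ℝ} {x : Fin n → ℝ} {μ : ℝ}
    (h : IsLNGMinGTR A0 A1 b0 b1 c1 x)
    (hstat : (A0.mulVec x + b0) + μ • (A1.mulVec x + b1) = 0) :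
    A1.mulVec x + b1 ≠ 0 := by
  intro hg
  have hx := h.constraint_active hA0 hA1
  obtain ⟨⟨hx', δ, hδ, hmin⟩, hng⟩ := h
  rw [hg, smul_zero, add_zero] at hstat
  refine hng ⟨hx', fun y hy => ?_⟩
  obtain ⟨d, rfl⟩ : ∃ d, y = x + d := ⟨y - x, by simp⟩
  obtain ⟨t, ht, ht0⟩ :=
    ((eventually_euclNorm_smul_lt x d hδ).and self_mem_nhdsWithin).exists
  have ht0 : 0 < t := ht0
  have h1 := hmin (x + t • d) (by
    rw [qf1_add hA1, hx, hg] at hy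
    rw [qf1_add hA1, hx, hg, dotProduct_mulVec_smul_self]
    simp only [zero_dotProduct, mul_zero, zero_add] at hy ⊢
    exact mul_nonpos_of_nonneg_of_nonpos (by positivity) hy) ht
  rw [qf0_add hA0, hstat, dotProduct_mulVec_smul_self] at h1
  rw [qf0_add hA0, hstat]
  simp only [zero_dotProduct, mul_zero, add_zero, le_add_iff_nonneg_right] at h1 ⊢
  exact nonneg_of_mul_nonneg_right h1 (by positivity)

/-- Sign of the Lagrange multiplier for an inequality constraint. -/
lemma IsLocalMinGTR.multiplier_nonneg {n : ℕ} {A0 A1 : Matrix (Fin n) (Fin n) ℝ}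
    (hA0 : A0.IsSymm) (hA1 : A1.IsSymm) {b0 b1 : Fin n → ℝ} {c1 : ℝ} {x : Fin n → ℝ} {μ : ℝ}
    (h : IsLocalMinGTR A0 A1 b0 b1 c1 x) (hx : qf1 A1 b1 c1 x = 0)
    (hstat : (A0.mulVec x + b0) + μ • (A1.mulVec x + b1) = 0)
    (hg : A1.mulVec x + b1 ≠ 0) : 0 ≤ μ := by
  obtain ⟨-, δ, hδ, hmin⟩ := h
  by_contra! hμ
  set g := A1.mulVec x + b1 with hgdef
  have hgg : 0 < g ⬝ᵥ g :=
    lt_of_le_of_ne (Finset.sum_nonneg fun i _ => mul_self_nonneg _)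
      (fun e => hg (dotProduct_self_eq_zero.1 e.symm))
  have hgrad : A0.mulVec x + b0 = -(μ • g) := eq_neg_of_add_eq_zero_left hstat
  obtain ⟨t, ⟨h1, h2⟩, h3⟩ := (((eventually_euclNorm_smul_lt x (-g) hδ).and
    (eventually_lin_add_sq_neg (show -2 * (g ⬝ᵥ g) < 0 by linarith)
      ((-g) ⬝ᵥ A1.mulVec (-g)))).and
    (eventually_lin_add_sq_neg (show 2 * (μ * (g ⬝ᵥ g)) < 0 by nlinarith)
      ((-g) ⬝ᵥ A0.mulVec (-g)))).exists
  have := hmin (x + t • -g) (by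
    rw [qf1_add hA1, hx, ← hgdef, dotProduct_mulVec_smul_self, dotProduct_smul, dotProduct_neg,
      smul_eq_mul]
    linarith) h1
  rw [qf0_add hA0, hgrad, dotProduct_mulVec_smul_self, dotProduct_smul, dotProduct_neg,
    neg_dotProduct, smul_dotProduct, smul_eq_mul, smul_eq_mul] at this
  linarith

lemma IsLocalMinGTR.isLocalMinGTRE {n : ℕ} {A0 A1 : Matrix (Fin n) (Fin n) ℝ}
    {b0 b1 : Fin n → ℝ} {c1 : ℝ} {x : Fin n → ℝ}
    (h : IsLocalMinGTR A0 A1 b0 b1 c1 x) (hx : qf1 A1 b1 c1 x = 0) :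
    IsLocalMinGTRE A0 A1 b0 b1 c1 x := by
  obtain ⟨-, δ, hδ, hmin⟩ := h
  exact ⟨hx, δ, hδ, fun y hy => hmin y hy.le⟩

lemma qf0_add_of_stationary {n : ℕ} {A0 A1 : Matrix (Fin n) (Fin n) ℝ}
    (hA0 : A0.IsSymm) (hA1 : A1.IsSymm) {b0 b1 : Fin n → ℝ} {c1 : ℝ} {x : Fin n → ℝ} {μ : ℝ}
    (hstat : (A0.mulVec x + b0) + μ • (A1.mulVec x + b1) = 0) (d : Fin n → ℝ) :
    qf0 A0 b0 (x + d) = qf0 A0 b0 x + d ⬝ᵥ (A0 + μ • A1).mulVec d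
      - μ * (qf1 A1 b1 c1 (x + d) - qf1 A1 b1 c1 x) := by
  have hs := congrArg (· ⬝ᵥ d) hstat
  simp only [add_dotProduct (_ + b0), smul_dotProduct, zero_dotProduct, smul_eq_mul] at hs
  rw [qf0_add hA0, qf1_add hA1, add_mulVec, dotProduct_add, smul_mulVec, dotProduct_smul,
    smul_eq_mul]
  linear_combination 2 * hs

lemma exists_eigenvalue_neg {n : ℕ} {H : Matrix (Fin n) (Fin n) ℝ} (hH : H.IsHermitian)
    {d : Fin n → ℝ} (hd : d ⬝ᵥ H.mulVec d < 0) : ∃ i, hH.eigenvalues i < 0 := by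
  by_contra! hall
  have hpsd : H.PosSemidef := hH.posSemidef_iff_eigenvalues_nonneg.2 hall
  have := hpsd.dotProduct_mulVec_nonneg d
  simp only [star_trivial] at this
  linarith

lemma eigenvalue_neg_unique {n : ℕ} {H : Matrix (Fin n) (Fin n) ℝ} (hH : H.IsHermitian)
    {g : Fin n → ℝ} (hg : ∀ d, g ⬝ᵥ d = 0 → 0 ≤ d ⬝ᵥ H.mulVec d) {i j : Fin n}
    (hi : hH.eigenvalues i < 0) (hj : hH.eigenvalues j < 0) : i = j := by
  by_contra hij
  set u : Fin n → ℝ := (hH.eigenvectorBasis i).ofLp with hu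
  set v : Fin n → ℝ := (hH.eigenvectorBasis j).ofLp with hv
  have hHu : H.mulVec u = hH.eigenvalues i • u := hH.mulVec_eigenvectorBasis i
  have hHv : H.mulVec v = hH.eigenvalues j • v := hH.mulVec_eigenvectorBasis j
  have hinner (k l : Fin n) : (hH.eigenvectorBasis k).ofLp ⬝ᵥ
      (hH.eigenvectorBasis l).ofLp = if l = k then 1 else 0 := by
    have := orthonormal_iff_ite.1 hH.eigenvectorBasis.orthonormal l k
    rw [← this, EuclideanSpace.inner_eq_star_dotProduct, star_trivial]
  have huu : u ⬝ᵥ u = 1 := by rw [hu, hinner, if_pos rfl]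
  have hvv : v ⬝ᵥ v = 1 := by rw [hv, hinner, if_pos rfl]
  have huv : u ⬝ᵥ v = 0 := by rw [hu, hv, hinner, if_neg (Ne.symm hij)]
  have hvu : v ⬝ᵥ u = 0 := by rw [dotProduct_comm, huv]
  have hquad (a b : ℝ) : (a • u + b • v) ⬝ᵥ H.mulVec (a • u + b • v) =
      a ^ 2 * hH.eigenvalues i + b ^ 2 * hH.eigenvalues j := by
    simp only [mulVec_add, mulVec_smul, hHu, hHv, dotProduct_add, add_dotProduct,
      smul_dotProduct, dotProduct_smul, smul_eq_mul, huu, hvv, huv, hvu]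
    ring
  have hgu : g ⬝ᵥ u ≠ 0 := by
    intro h0
    have := hg ((1 : ℝ) • u + (0 : ℝ) • v) (by simp [h0])
    rw [hquad] at this
    linarith
  have := hg ((g ⬝ᵥ v) • u + (-(g ⬝ᵥ u)) • v) (by
    simp only [dotProduct_add, dotProduct_smul, smul_eq_mul]
    ring)
  rw [hquad] at this
  have h1 : 0 < (-(g ⬝ᵥ u)) ^ 2 := sq_pos_of_ne_zero (neg_ne_zero.2 hgu)
  nlinarith [mul_neg_of_pos_of_neg h1 hj, sq_nonneg (g ⬝ᵥ v)]

theorem stmt4 {n : ℕ} (hn : 1 ≤ n)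
    (A0 A1 : Matrix (Fin n) (Fin n) ℝ) (hA0 : A0.IsSymm) (hA1 : A1.IsSymm)
    (b0 b1 : Fin n → ℝ) (c1 : ℝ) (xs : Fin n → ℝ) (μ : ℝ)
    (hx : IsLNGMinGTRE A0 A1 b0 b1 c1 xs ∨ IsLNGMinGTR A0 A1 b0 b1 c1 xs)
    (hstat : (A0.mulVec xs + b0) + μ • (A1.mulVec xs + b1) = 0) :
    ∀ hH : (A0 + μ • A1).IsHermitian,
      (Finset.univ.filter fun i => hH.eigenvalues i < 0).card = 1 := by
  intro hH
  have key : A1.mulVec xs + b1 ≠ 0 ∧ IsLocalMinGTRE A0 A1 b0 b1 c1 xs ∧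
      ∃ d : Fin n → ℝ, d ⬝ᵥ (A0 + μ • A1).mulVec d < 0 := by
    rcases hx with h | h
    · refine ⟨h.gradient_ne_zero hA0 hA1 hstat, h.1, ?_⟩
      by_contra! hpos
      refine h.2 ⟨h.1.1, fun y hy => ?_⟩
      obtain ⟨d, rfl⟩ : ∃ d, y = xs + d := ⟨y - xs, by simp⟩
      rw [qf0_add_of_stationary (c1 := c1) hA0 hA1 hstat, hy, h.1.1]
      linarith [hpos d]
    · have hact := h.constraint_active hA0 hA1
      have hg := h.gradient_ne_zero hA0 hA1 hstat
      have hμ := h.1.multiplier_nonneg hA0 hA1 hact hstat hg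
      refine ⟨hg, h.1.isLocalMinGTRE hact, ?_⟩
      by_contra! hpos
      refine h.2 ⟨h.1.1, fun y hy => ?_⟩
      obtain ⟨d, rfl⟩ : ∃ d, y = xs + d := ⟨y - xs, by simp⟩
      rw [qf0_add_of_stationary (c1 := c1) hA0 hA1 hstat, hact]
      linarith [hpos d, mul_nonpos_of_nonneg_of_nonpos hμ hy]
  obtain ⟨hg, hloc, d, hd⟩ := key
  obtain ⟨i, hi⟩ := exists_eigenvalue_neg hH hd
  refine Finset.card_eq_one.2 ⟨i, Finset.ext fun j => ?_⟩
  simp only [Finset.mem_filter, Finset.mem_univ, true_and, Finset.mem_singleton]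
  refine ⟨fun hj => ?_, fun hj => hj ▸ hi⟩
  exact eigenvalue_neg_unique hH
    (fun d hd => hloc.tangent_nonneg hA0 hA1 hstat hg hd) hj hi
end
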